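/- Any Mueller matrix of a general filter, M = Σ_e p_e M^{(e)} with p_e ≥ 0, Σ p_e = 1, and each M^{(e)} a pure Mueller matrix, maps the cone of physical Stokes vectors (S_0 ≥ 0, S_0² ≥ S_1²+S_2²+S_3²) into itself. -/

import Mathlib

open Matrix

/-- `pauli 0 = I`, and `pauli 1, pauli 2, pauli 3` are the Pauli matrices
`σ_z, σ_x, σ_y` respectively (the paper's convention). -/
noncomputable def pauli : Fin 4 → Matrix (Fin 2) (Fin 2) ℂ :=
  ![1, !![1, 0; 0, -1], !![0, 1; 1, 0], !![0, -Complex.I; Complex.I, 0]]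

open scoped ComplexOrder

/-- The Hermitian matrix `∑ ν, S ν • σ_ν`, twice the density matrix of the Stokes vector `S`. -/
noncomputable def stokesMatrix (S : Fin 4 → ℝ) : Matrix (Fin 2) (Fin 2) ℂ :=
  ∑ ν, (S ν : ℂ) • pauli ν

theorem posSemidef_fin_two_of_trace_det {A : Matrix (Fin 2) (Fin 2) ℂ} (hA : A.IsHermitian)
    (htr : 0 ≤ A.trace.re) (hdet : 0 ≤ A.det.re) : A.PosSemidef := by
  rw [hA.trace_eq_sum_eigenvalues, Fin.sum_univ_two] at htr
  rw [hA.det_eq_prod_eigenvalues, Fin.prod_univ_two] at hdet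
  simp at htr hdet
  rw [hA.posSemidef_iff_eigenvalues_nonneg]
  intro i
  fin_cases i <;> simp <;> by_contra! h <;> nlinarith

theorem stokesMatrix_eq (S : Fin 4 → ℝ) :
    stokesMatrix S = !![(S 0 + S 1 : ℂ), S 2 - S 3 * Complex.I;
      S 2 + S 3 * Complex.I, (S 0 - S 1 : ℂ)] := by
  ext i j
  fin_cases i <;> fin_cases j <;>
    simp [stokesMatrix, pauli, Fin.sum_univ_four, sub_eq_add_neg]

theorem posSemidef_stokesMatrix {S : Fin 4 → ℝ} (hS0 : 0 ≤ S 0)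
    (hScone : S 1 ^ 2 + S 2 ^ 2 + S 3 ^ 2 ≤ S 0 ^ 2) : (stokesMatrix S).PosSemidef := by
  rw [stokesMatrix_eq]
  apply posSemidef_fin_two_of_trace_det
  · ext i j
    fin_cases i <;> fin_cases j <;> simp [sub_eq_add_neg]
  · simp [trace_fin_two]
    linarith
  · simp [det_fin_two]
    nlinarith

/-- The Stokes vector of a positive semidefinite matrix is real and physical. -/
theorem Matrix.PosSemidef.stokes_mem_cone {A : Matrix (Fin 2) (Fin 2) ℂ} (hA : A.PosSemidef)
    {s : Fin 4 → ℂ} (hs : ∀ μ, s μ = (1 / 2 : ℂ) * (pauli μ * A).trace) :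
    (∀ μ, (s μ).im = 0) ∧ 0 ≤ (s 0).re ∧
      (s 1).re ^ 2 + (s 2).re ^ 2 + (s 3).re ^ 2 ≤ (s 0).re ^ 2 := by
  have htr := (Complex.le_def.mp hA.trace_nonneg).1
  have hdet := (Complex.le_def.mp hA.det_nonneg).1
  have h00 : (A 0 0).im = 0 := Complex.conj_eq_iff_im.mp (hA.isHermitian.apply 0 0)
  have h11 : (A 1 1).im = 0 := Complex.conj_eq_iff_im.mp (hA.isHermitian.apply 1 1)
  have h10 : A 1 0 = star (A 0 1) := (hA.isHermitian.apply 1 0).symm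
  simp [trace_fin_two, det_fin_two, h00, h11, h10] at htr hdet
  refine ⟨fun μ => ?_, ?_, ?_⟩
  · fin_cases μ <;>
      simp [hs, pauli, trace_fin_two, vecMul, dotProduct, Fin.sum_univ_two, h00, h11, h10]
  · simp [hs, pauli, trace_fin_two]
    linarith
  · simp [hs, pauli, trace_fin_two, vecMul, dotProduct, Fin.sum_univ_two, h10]
    nlinarith

theorem pure_mueller_mulVec (T : Matrix (Fin 2) (Fin 2) ℂ) (S : Fin 4 → ℝ) (μ : Fin 4) :
    ∑ ν, (1 / 2 : ℂ) * (pauli μ * T * pauli ν * Tᴴ).trace * (S ν : ℂ) =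
      (1 / 2 : ℂ) * (pauli μ * (T * stokesMatrix S * Tᴴ)).trace := by
  simp only [stokesMatrix, Finset.mul_sum, Finset.sum_mul, trace_sum, mul_smul_comm, smul_mul_assoc,
    trace_smul, smul_eq_mul, Matrix.mul_assoc]
  exact Finset.sum_congr rfl fun ν _ => by ring

/-- A general-filter Mueller matrix `M = ∑ e, p e • M⁽ᵉ⁾` (convex
combination of pure Mueller matrices of Jones matrices `T e`) maps the cone of
physical Stokes vectors (`S₀ ≥ 0`, `S₀² ≥ S₁² + S₂² + S₃²`) into itself. -/
theorem general_mueller_preserves_stokes_cone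
    (n : ℕ) (T : Fin n → Matrix (Fin 2) (Fin 2) ℂ)
    (p : Fin n → ℝ) (hp : ∀ e, 0 ≤ p e) (hsum : ∑ e : Fin n, p e = 1)
    (M : Fin 4 → Fin 4 → ℂ)
    (hM : ∀ μ ν, M μ ν =
      ∑ e : Fin n, (p e : ℂ) * ((1 / 2 : ℂ) * (pauli μ * T e * pauli ν * (T e)ᴴ).trace))
    (S : Fin 4 → ℝ)
    (hS0 : 0 ≤ S 0) (hScone : S 1 ^ 2 + S 2 ^ 2 + S 3 ^ 2 ≤ S 0 ^ 2)
    (S' : Fin 4 → ℂ) (hS' : ∀ μ, S' μ = ∑ ν : Fin 4, M μ ν * (S ν : ℂ)) :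
    (∀ μ, (S' μ).im = 0) ∧
    0 ≤ (S' 0).re ∧
    (S' 1).re ^ 2 + (S' 2).re ^ 2 + (S' 3).re ^ 2 ≤ (S' 0).re ^ 2 := by
  have hΦ : (∑ e, (p e : ℂ) • (T e * stokesMatrix S * (T e)ᴴ)).PosSemidef :=
    posSemidef_sum _ fun e _ =>
      ((posSemidef_stokesMatrix hS0 hScone).mul_mul_conjTranspose_same (T e)).smul
        (Complex.zero_le_real.mpr (hp e))
  refine hΦ.stokes_mem_cone fun μ => ?_
  simp only [hS', hM, Finset.sum_mul, Finset.mul_sum, trace_sum, mul_smul_comm, trace_smul,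
    smul_eq_mul]
  rw [Finset.sum_comm]
  refine Finset.sum_congr rfl fun e _ => ?_
  rw [mul_left_comm, ← pure_mueller_mulVec, Finset.mul_sum]
  exact Finset.sum_congr rfl fun ν _ => by ring
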